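/- There exist a finite connected graph G (a grid), disjoint agent sets A and B, a common favorite node for all agents, and window size w = 1 such that for every tolerance parameter τ with 1/3 < τ ≤ 1/2 there is an improving response cycle in the common-favorites jump Schelling game: a sequence of placements p_0, p_1, …, p_6 with p_6 = p_0 in which each p_{i+1} arises from p_i by an improving jump of a single agent. Consequently, for 1/3 < τ ≤ 1/2 there exists no ordinal potential function for the cf-JSG (and hence for the JSG). -/

import Mathlib

open SimpleGraph Finset

namespace Schelling

variable {V I : Type*}

/-- The `w`-neighborhood of a node `u`: all nodes `v ≠ u` with `d_G(u,v) ≤ w`. -/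
def nbhd (G : SimpleGraph V) (w : ℕ) (u : V) : Set V :=
  {v | v ≠ u ∧ G.dist u v ≤ w}

/-- `|N⁺(p(x))|`: number of nodes in the `w`-neighborhood of `p x` occupied by
agents of the same type as `x`. -/
noncomputable def sCount (G : SimpleGraph V) (w : ℕ) (tp : I → Bool) (p : I → V) (x : I) : ℕ :=
  {v | v ∈ nbhd G w (p x) ∧ ∃ y, p y = v ∧ tp y = tp x}.ncard

/-- `|N⁻(p(x))|`: number of nodes in the `w`-neighborhood of `p x` occupied by
agents of the other type. -/
noncomputable def dCount (G : SimpleGraph V) (w : ℕ) (tp : I → Bool) (p : I → V) (x : I) : ℕ :=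
  {v | v ∈ nbhd G w (p x) ∧ ∃ y, p y = v ∧ tp y ≠ tp x}.ncard

/-- An agent is isolated if no node of its neighborhood is occupied. -/
def isolated (G : SimpleGraph V) (w : ℕ) (tp : I → Bool) (p : I → V) (x : I) : Prop :=
  sCount G w tp p x + dCount G w tp p x = 0

/-- The (scalar) cost of agent `x`: `τ` if isolated, otherwise
`max 0 (τ - |N⁺|/(|N⁺| + |N⁻|))`. -/
noncomputable def ucost (G : SimpleGraph V) (w : ℕ) (τ : ℝ) (tp : I → Bool) (p : I → V)
    (x : I) : ℝ :=
  if sCount G w tp p x + dCount G w tp p x = 0 then τ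
  else max 0 (τ - (sCount G w tp p x : ℝ) / ((sCount G w tp p x : ℝ) + (dCount G w tp p x : ℝ)))

/-- An agent is happy if it is not isolated and its local happiness ratio is at least `τ`. -/
def happy (G : SimpleGraph V) (w : ℕ) (τ : ℝ) (tp : I → Bool) (p : I → V) (x : I) : Prop :=
  sCount G w tp p x + dCount G w tp p x ≠ 0 ∧
    τ ≤ (sCount G w tp p x : ℝ) / ((sCount G w tp p x : ℝ) + (dCount G w tp p x : ℝ))

/-- The vector cost of agent `x`: scalar cost together with `d_G(fav_x, p x) + 1`,
to be compared lexicographically. -/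
noncomputable def vcost (G : SimpleGraph V) (w : ℕ) (τ : ℝ) (tp : I → Bool) (fav : I → V)
    (p : I → V) (x : I) : ℝ × ℕ :=
  (ucost G w τ tp p x, G.dist (fav x) (p x) + 1)

/-- The number of colored pairs `Φ(p) = (1/2) · Σ_x |N⁻(p(x))|`. -/
noncomputable def Phi [Fintype I] (G : SimpleGraph V) (w : ℕ) (tp : I → Bool) (p : I → V) : ℝ :=
  (1 / 2) * ∑ x : I, (dCount G w tp p x : ℝ)

/-- The pair potential `(Φ(p), Σ_x d_G(fav_x, p x))`, compared lexicographically. -/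
noncomputable def PhiPair [Fintype I] (G : SimpleGraph V) (w : ℕ) (tp : I → Bool) (fav : I → V)
    (p : I → V) : ℝ × ℕ :=
  (Phi G w tp p, ∑ x : I, G.dist (fav x) (p x))

/-- The placement obtained from `p` by swapping the locations of agents `x` and `y`. -/
def swapP [DecidableEq I] (p : I → V) (x y : I) : I → V := p ∘ Equiv.swap x y

/-- The agents of type `A`. -/
def typeA [Fintype I] (tp : I → Bool) : Finset I := Finset.univ.filter (fun i => tp i = true)

/-- The agents of type `B`. -/
def typeB [Fintype I] (tp : I → Bool) : Finset I := Finset.univ.filter (fun i => tp i = false)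

/-- A placement is stable for the uniform SSG if no pair of agents can both strictly
decrease their cost by swapping. -/
def uStable (G : SimpleGraph V) (w : ℕ) (τ : ℝ) (tp : I → Bool) (p : I → V)
    [DecidableEq I] : Prop :=
  ∀ x y : I, ¬ (ucost G w τ tp (swapP p x y) x < ucost G w τ tp p x ∧
                ucost G w τ tp (swapP p x y) y < ucost G w τ tp p y)

/-- A placement is stable for the SSG with favorite nodes if no pair of agents can both
strictly lexicographically decrease their cost vector by swapping. -/
def vStable (G : SimpleGraph V) (w : ℕ) (τ : ℝ) (tp : I → Bool) (fav : I → V) (p : I → V)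
    [DecidableEq I] : Prop :=
  ∀ x y : I, ¬ (toLex (vcost G w τ tp fav (swapP p x y) x) < toLex (vcost G w τ tp fav p x) ∧
                toLex (vcost G w τ tp fav (swapP p x y) y) < toLex (vcost G w τ tp fav p y))



open Classical in
/-- The weight of the (ordered) pair of nodes `(u,v)` in the jump-game potential:
`1` if both are occupied by agents of different types, `1/3` if at least one is empty,
and `0` otherwise. -/
noncomputable def edgeW (tp : I → Bool) (p : I → V) (u v : V) : ℝ :=
  if ∃ x y : I, p x = u ∧ p y = v ∧ tp x ≠ tp y then 1
  else if (∀ x : I, p x ≠ u) ∨ (∀ y : I, p y ≠ v) then 1 / 3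
  else 0

open Classical in
/-- The edge-weight potential `Φ(p) = Σ_{e ∈ E} w_e(p)`, written as half the sum over
ordered adjacent pairs (each edge is counted twice, and `edgeW` is symmetric). -/
noncomputable def jumpPhi [Fintype V] (G : SimpleGraph V) (tp : I → Bool) (p : I → V) : ℝ :=
  (1 / 2) * ∑ u : V, ∑ v : V, if G.Adj u v then edgeW tp p u v else 0

/-- A placement is stable for the uniform JSG if no agent can strictly decrease her cost
by jumping to an empty node. -/
def jStable (G : SimpleGraph V) (w : ℕ) (τ : ℝ) (tp : I → Bool) (p : I → V)
    [DecidableEq I] : Prop :=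
  ∀ (x : I) (v : V), v ∉ Set.range p →
    ¬ (ucost G w τ tp (Function.update p x v) x < ucost G w τ tp p x)

/-- The social cost of a placement: the number of unhappy agents together with the total
distance cost, compared lexicographically. -/
noncomputable def socialCost [Fintype I] (G : SimpleGraph V) (w : ℕ) (τ : ℝ) (tp : I → Bool)
    (fav : I → V) (p : I → V) : ℕ × ℕ :=
  ({x : I | ¬ happy G w τ tp p x}.ncard, ∑ x : I, (G.dist (fav x) (p x) + 1))


end Schelling

open Schelling

namespace SchellingLow

/-- Manhattan distance on the 2 x 4 grid, node `k` in row `k / 4`, column `k % 4`. -/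
def gd (u v : Fin 8) : ℕ :=
  (u.val / 4 - v.val / 4) + (v.val / 4 - u.val / 4) +
    ((u.val % 4 - v.val % 4) + (v.val % 4 - u.val % 4))

/-- The 2 x 4 grid. -/
def Gr : SimpleGraph (Fin 8) where
  Adj u v := gd u v = 1
  symm := ⟨by decide⟩
  loopless := ⟨by decide⟩

instance : DecidableRel Gr.Adj := fun u v => inferInstanceAs (Decidable (gd u v = 1))

lemma walk_le {u v : Fin 8} (w : Gr.Walk u v) : gd u v ≤ w.length := by
  induction w with
  | nil => simp [gd]
  | @cons a b c h w ih =>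
    have key : ∀ a b c : Fin 8, Gr.Adj a b → gd a c ≤ gd b c + 1 := by decide
    have := key a b c h
    simp only [SimpleGraph.Walk.length_cons]
    omega

lemma exists_walk : ∀ (n : ℕ) (u v : Fin 8), gd u v = n → ∃ w : Gr.Walk u v, w.length = n := by
  intro n
  induction n with
  | zero =>
    intro u v h
    have key : ∀ a b : Fin 8, gd a b = 0 → a = b := by decide
    obtain rfl := key u v h
    exact ⟨.nil, rfl⟩
  | succ n ih =>
    intro u v h
    have key : ∀ a b : Fin 8, gd a b ≠ 0 → ∃ c, Gr.Adj a c ∧ gd c b + 1 = gd a b := by decide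
    obtain ⟨c, hc, hd⟩ := key u v (by omega)
    obtain ⟨w, hw⟩ := ih c v (by omega)
    exact ⟨.cons hc w, by simp [hw]⟩

lemma conn : Gr.Connected := by
  have : Gr.Preconnected := fun u v => (exists_walk _ u v rfl).elim fun w _ => ⟨w⟩
  exact ⟨this⟩

lemma dist_eq (u v : Fin 8) : Gr.dist u v = gd u v := by
  apply le_antisymm
  · obtain ⟨w, hw⟩ := exists_walk _ u v rfl
    exact hw ▸ SimpleGraph.dist_le w
  · obtain ⟨w, hw⟩ := conn.exists_walk_length_eq_dist u v
    exact hw ▸ walk_le w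

/-- Types: agents 0-3 against agents 4-6. -/
def ty (i : Fin 7) : Bool := decide (i.val < 4)

/-- Computable count of same-type neighbors. -/
def cS (p : Fin 7 → Fin 8) (x : Fin 7) : ℕ :=
  (univ.filter fun v : Fin 8 => gd (p x) v = 1 ∧ ∃ y, p y = v ∧ ty y = ty x).card

/-- Computable count of other-type neighbors. -/
def cD (p : Fin 7 → Fin 8) (x : Fin 7) : ℕ :=
  (univ.filter fun v : Fin 8 => gd (p x) v = 1 ∧ ∃ y, p y = v ∧ ty y ≠ ty x).card

lemma mem_nb (u v : Fin 8) : v ∈ nbhd Gr 1 u ↔ gd u v = 1 := by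
  simp only [nbhd, Set.mem_setOf_eq, dist_eq]
  revert u v
  decide

lemma sC (p : Fin 7 → Fin 8) (x : Fin 7) : sCount Gr 1 ty p x = cS p x := by
  simp only [sCount, cS, mem_nb]
  rw [← Set.ncard_coe_finset]
  congr 1
  ext v
  simp

lemma dC (p : Fin 7 → Fin 8) (x : Fin 7) : dCount Gr 1 ty p x = cD p x := by
  simp only [dCount, cD, mem_nb]
  rw [← Set.ncard_coe_finset]
  congr 1
  ext v
  simp

/-- Happy for every `τ ≤ 1/2`. -/
abbrev hap (p : Fin 7 → Fin 8) (x : Fin 7) : Prop := cS p x + cD p x ≠ 0 ∧ cD p x ≤ cS p x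

/-- Unhappy for every `τ > 1/3`. -/
abbrev unh (p : Fin 7 → Fin 8) (x : Fin 7) : Prop := 2 * cS p x ≤ cD p x

lemma u_hap {τ : ℝ} (h2 : τ ≤ 1 / 2) {p x} (h : hap p x) : ucost Gr 1 τ ty p x = 0 := by
  obtain ⟨h0, h1⟩ := h
  rw [ucost, sC, dC, if_neg h0]
  apply max_eq_left
  have h0' : (0 : ℝ) < (cS p x : ℝ) + cD p x := by exact_mod_cast Nat.pos_of_ne_zero h0
  have h1' : (cD p x : ℝ) ≤ cS p x := by exact_mod_cast h1
  have : (1 / 2 : ℝ) ≤ (cS p x : ℝ) / ((cS p x : ℝ) + cD p x) := by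
    rw [le_div_iff₀ h0']; linarith
  linarith

lemma u_unh {τ : ℝ} (h1 : 1 / 3 < τ) {p x} (h : unh p x) : 0 < ucost Gr 1 τ ty p x := by
  rw [ucost, sC, dC]
  split_ifs with h0
  · linarith
  · apply lt_max_of_lt_right
    have h0' : (0 : ℝ) < (cS p x : ℝ) + cD p x := by exact_mod_cast Nat.pos_of_ne_zero h0
    have h1' : 2 * (cS p x : ℝ) ≤ cD p x := by exact_mod_cast h
    have : (cS p x : ℝ) / ((cS p x : ℝ) + cD p x) ≤ 1 / 3 := by
      rw [div_le_iff₀ h0']; linarith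
    linarith

lemma u_zero {τ : ℝ} (h1 : 1 / 3 < τ) {p x} (h : cS p x = 0) : ucost Gr 1 τ ty p x = τ := by
  rw [ucost, sC, dC, h]
  split_ifs with h0
  · rfl
  · simp; linarith

/-- Decidable sufficient condition for an improvement. -/
abbrev better (p q : Fin 7 → Fin 8) (x : Fin 7) : Prop :=
  (unh p x ∧ hap q x) ∨
  (hap p x ∧ hap q x ∧ gd 6 (q x) < gd 6 (p x)) ∨
  (cS p x = 0 ∧ cS q x = 0 ∧ gd 6 (q x) < gd 6 (p x))

lemma better_lt {τ : ℝ} (h1 : 1 / 3 < τ) (h2 : τ ≤ 1 / 2) {p q x} (h : better p q x) :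
    toLex (vcost Gr 1 τ ty (fun _ => 6) q x) < toLex (vcost Gr 1 τ ty (fun _ => 6) p x) := by
  rw [Prod.Lex.toLex_lt_toLex]
  simp only [vcost, dist_eq]
  rcases h with ⟨a, b⟩ | ⟨a, b, c⟩ | ⟨a, b, c⟩
  · left; rw [u_hap h2 b]; exact u_unh h1 a
  · right; rw [u_hap h2 b, u_hap h2 a]; exact ⟨rfl, by omega⟩
  · right; rw [u_zero h1 b, u_zero h1 a]; exact ⟨rfl, by omega⟩

/-- The cycle. -/
def P : Fin 7 → Fin 7 → Fin 8 :=
  ![![6, 7, 0, 1, 3, 5, 2], ![4, 7, 0, 1, 3, 5, 2], ![4, 6, 0, 1, 3, 5, 2],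
    ![7, 6, 0, 1, 3, 5, 2], ![7, 4, 0, 1, 3, 5, 2], ![6, 4, 0, 1, 3, 5, 2],
    ![6, 7, 0, 1, 3, 5, 2]]

/-- The moving agents. -/
def X : Fin 6 → Fin 7 := ![0, 1, 0, 1, 0, 1]

/-- The targets. -/
def T : Fin 6 → Fin 8 := ![4, 6, 7, 4, 6, 7]

lemma P_inj : ∀ i, Function.Injective (P i) := by decide

lemma P_emp : ∀ i : Fin 6, T i ∉ Set.range (P i.castSucc) := by
  simp only [Set.mem_range]
  decide

lemma P_upd : ∀ i : Fin 6, P i.succ = Function.update (P i.castSucc) (X i) (T i) := by decide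

lemma P_bet : ∀ i : Fin 6, better (P i.castSucc) (P i.succ) (X i) := by decide

end SchellingLow

open SchellingLow

/-- There exist a finite connected graph `G` (a grid), disjoint agent sets,
a common favorite node and window size `w = 1` such that for every `τ` with `1/3 < τ ≤ 1/2`
the common-favorites jump Schelling game has an improving response cycle
`p_0, …, p_6` with `p_6 = p_0`; consequently, for such `τ` no ordinal potential function
exists for the cf-JSG (and hence for the JSG). -/

theorem cfJSG_IRC_low :
    ∃ (V : Type) (_ : Fintype V) (I : Type) (_ : Fintype I) (_ : DecidableEq I)
      (G : SimpleGraph V) (tp : I → Bool) (fav : I → V),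
      G.Connected ∧
      (∃ v0 : V, ∀ i : I, fav i = v0) ∧
      2 ≤ (typeA tp).card ∧ 2 ≤ (typeB tp).card ∧
      Fintype.card I < Fintype.card V ∧
      ∀ τ : ℝ, 1 / 3 < τ → τ ≤ 1 / 2 →
        (∃ p : Fin 7 → I → V,
          (∀ i : Fin 7, Function.Injective (p i)) ∧
          p 6 = p 0 ∧
          (∀ i : Fin 6, ∃ (x : I) (v : V),
            v ∉ Set.range (p i.castSucc) ∧
            p i.succ = Function.update (p i.castSucc) x v ∧
            toLex (vcost G 1 τ tp fav (p i.succ) x) <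
              toLex (vcost G 1 τ tp fav (p i.castSucc) x))) ∧
        ¬ ∃ f : (I → V) → ℝ, ∀ q : I → V, Function.Injective q →
            ∀ (x : I) (v : V), v ∉ Set.range q →
              toLex (vcost G 1 τ tp fav (Function.update q x v) x) <
                toLex (vcost G 1 τ tp fav q x) →
              f (Function.update q x v) < f q := by
  refine ⟨Fin 8, inferInstance, Fin 7, inferInstance, inferInstance, Gr, ty, fun _ => 6, conn,
    ⟨6, fun _ => rfl⟩, by decide, by decide, by decide, ?_⟩
  intro τ h1 h2
  have step := fun i => better_lt h1 h2 (P_bet i)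
  refine ⟨⟨P, P_inj, rfl, fun i => ⟨X i, T i, P_emp i, P_upd i, step i⟩⟩, ?_⟩
  rintro ⟨f, hf⟩
  have key : ∀ i : Fin 6, f (P i.succ) < f (P i.castSucc) := by
    intro i
    have := hf (P i.castSucc) (P_inj _) (X i) (T i) (P_emp i)
    rw [← P_upd i] at this
    exact this (step i)
  have e : f (P 6) = f (P 0) := rfl
  have k0 : f (P 1) < f (P 0) := key 0
  have k1 : f (P 2) < f (P 1) := key 1
  have k2 : f (P 3) < f (P 2) := key 2
  have k3 : f (P 4) < f (P 3) := key 3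
  have k4 : f (P 5) < f (P 4) := key 4
  have k5 : f (P 6) < f (P 5) := key 5
  linarith
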